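/- For every integer K ≥ 1 and every prime p, the K×K matrix over Z/pZ whose (k, ℓ) entry (for 1 ≤ k, ℓ ≤ K) is the binomial coefficient C(k + ℓ − 1, ℓ) reduced mod p is nonsingular (its determinant is nonzero in Z/pZ). In particular, the integer matrix with entries C(k + ℓ − 1, ℓ) has nonzero determinant. -/

import Mathlib

theorem aux_choose (K k l : ℕ) (hk : k < K) :
    Nat.choose (k + l + 1) (l + 1) =
      ∑ j ∈ Finset.range K, Nat.choose (k + 1) (j + 1) * Nat.choose l j := by
  have h1 : Nat.choose (k + l + 1) (l + 1) = Nat.choose (l + (k + 1)) k := by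
    rw [show l + (k + 1) = k + l + 1 by ring]
    exact Nat.choose_symm_of_eq_add (by ring)
  rw [h1, Nat.add_choose_eq, Finset.Nat.sum_antidiagonal_eq_sum_range_succ_mk]
  have hsub : Finset.range (k + 1) ⊆ Finset.range K := by
    intro x hx
    simp only [Finset.mem_range] at *
    omega
  rw [← Finset.sum_subset hsub]
  · refine Finset.sum_congr rfl fun j hj => ?_
    have hj' : j < k + 1 := Finset.mem_range.mp hj
    rw [mul_comm]
    congr 1
    exact Nat.choose_symm_of_eq_add (by omega)
  · intro j _ hj
    rw [Finset.mem_range] at hj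
    rw [Nat.choose_eq_zero_of_lt (by omega), zero_mul]

theorem aux_det (R : Type) [CommRing R] (K : ℕ) :
    Matrix.det (Matrix.of fun k l : Fin K =>
        (Nat.choose ((k : ℕ) + (l : ℕ) + 1) ((l : ℕ) + 1) : R)) = 1 := by
  have h : (Matrix.of fun k l : Fin K =>
        (Nat.choose ((k : ℕ) + (l : ℕ) + 1) ((l : ℕ) + 1) : R)) =
      (Matrix.of fun k j : Fin K => (Nat.choose ((k : ℕ) + 1) ((j : ℕ) + 1) : R)) *
      (Matrix.of fun j l : Fin K => (Nat.choose (l : ℕ) (j : ℕ) : R)) := by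
    ext k l
    rw [Matrix.mul_apply]
    simp only [Matrix.of_apply]
    rw [aux_choose K k l k.2, ← Fin.sum_univ_eq_sum_range
      (fun j => Nat.choose ((k : ℕ) + 1) (j + 1) * Nat.choose (l : ℕ) j)]
    push_cast
    rfl
  rw [h, Matrix.det_mul, Matrix.det_of_isLowerTriangular, Matrix.det_of_isUpperTriangular]
  · simp
  · intro i j hij
    have : (j : ℕ) < i := hij
    simp [Nat.choose_eq_zero_of_lt this]
  · intro i j hij
    have : (i : ℕ) < j := hij
    simp [Nat.choose_eq_zero_of_lt (Nat.succ_lt_succ this)]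

/-- for every `K ≥ 1` and every prime `p`, the `K × K` matrix whose
`(k, ℓ)` entry (indices `1 ≤ k, ℓ ≤ K`, here realised by `Fin K` with an index
shift) is the binomial coefficient `C(k + ℓ - 1, ℓ) mod p` is nonsingular; in
particular the corresponding integer matrix has nonzero determinant. -/
theorem binomial_matrix_nonsingular
    (K : ℕ) (hK : 1 ≤ K) (p : ℕ) (hp : p.Prime) :
    Matrix.det (Matrix.of fun k l : Fin K =>
        (Nat.choose ((k : ℕ) + (l : ℕ) + 1) ((l : ℕ) + 1) : ZMod p)) ≠ 0 ∧
    Matrix.det (Matrix.of fun k l : Fin K =>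
        (Nat.choose ((k : ℕ) + (l : ℕ) + 1) ((l : ℕ) + 1) : ℤ)) ≠ 0 := by
  haveI : Fact p.Prime := ⟨hp⟩
  rw [aux_det, aux_det]
  exact ⟨one_ne_zero, one_ne_zero⟩
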